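/- Fix z, w, u ∈ ℝ^d, γ > 0 and τ ∈ (0,1). Define z^{1/2} := τ·z + (1−τ)·w − γ·F(w) and z^+ := z^{1/2} − γ·Q^serv[(1/M)·∑_{m=1}^M Q_m^dev(F_m(z^{1/2}) − F_m(w))], where Q^serv is an unbiased compressor with parameter q^serv, each Q_m^dev is an unbiased compressor with parameter q_m^dev, and all compressor evaluations are mutually independent. Then E[‖z^+ − u‖²] ≤ τ·‖z − u‖² + (1−τ)·‖w − u‖² − 2γ·⟨F(z^{1/2}), z^{1/2} − u⟩ − (1 − τ − γ²·C_q²)·‖w − z^{1/2}‖² − τ·‖z^{1/2} − z‖², where C_q² := (q^serv/M²)·∑_{m=1}^M (q_m^dev·L_m² + (M−1)·L̃²). -/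

import Mathlib

open MeasureTheory ProbabilityTheory Finset
open scoped RealInnerProductSpace ENNReal

lemma norm_sum_sq_le_card_mul_sum_norm_sq {V ι : Type*} [SeminormedAddCommGroup V]
    (s : Finset ι) (x : ι → V) :
    ‖∑ i ∈ s, x i‖ ^ 2 ≤ #s * ∑ i ∈ s, ‖x i‖ ^ 2 :=
  (pow_le_pow_left₀ (norm_nonneg _) (norm_sum_le s x) 2).trans sq_sum_le_card_mul_sum_sq

section SumsOfIndependent

variable {V : Type*} [NormedAddCommGroup V] [MeasurableSpace V] [BorelSpace V]
  [SecondCountableTopology V] {Ω : Type*} [MeasurableSpace Ω] {P : Measure Ω}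
  [IsProbabilityMeasure P]

lemma ProbabilityTheory.IndepFun.memLp_two_right_of_memLp_add {X Y : Ω → V}
    (hXY : IndepFun X Y P) (hX : Measurable X) (hY : Measurable Y)
    (h : MemLp (fun ω ↦ X ω + Y ω) 2 P) : MemLp Y 2 P := by
  have hint := (memLp_two_iff_integrable_sq_norm h.1).1 h
  have hmap : Integrable (fun p : V × V ↦ ‖p.1 + p.2‖ ^ 2) ((P.map X).prod (P.map Y)) := by
    rw [← (indepFun_iff_map_prod_eq_prod_map_map hX.aemeasurable hY.aemeasurable).1 hXY,
      integrable_map_measure (by fun_prop) (by fun_prop)]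
    exact hint
  have := Measure.isProbabilityMeasure_map (μ := P) hX.aemeasurable
  have := Measure.isProbabilityMeasure_map (μ := P) hY.aemeasurable
  obtain ⟨x, hx⟩ := hmap.prod_right_ae.exists
  have hx' : MemLp (fun y : V ↦ x + y) 2 (P.map Y) :=
    (memLp_two_iff_integrable_sq_norm (by fun_prop)).2 hx
  have hid : MemLp (fun y : V ↦ y) 2 (P.map Y) := by
    convert hx'.sub (memLp_const x) using 1
    ext1 y
    simp
  exact hid.comp_of_map hY.aemeasurable

lemma ProbabilityTheory.iIndepFun.memLp_two_of_memLp_sum {ι : Type*} [Fintype ι] {X : ι → Ω → V}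
    (hX : iIndepFun X P) (hm : ∀ i, Measurable (X i)) (h : MemLp (fun ω ↦ ∑ i, X i ω) 2 P)
    (i : ι) : MemLp (X i) 2 P := by
  classical
  refine (hX.indepFun_finsetSum_of_notMem hm
    (notMem_erase i univ)).memLp_two_right_of_memLp_add (by fun_prop) (hm i) ?_
  convert h using 2 with ω
  rw [Finset.sum_apply, sum_erase_add _ _ (mem_univ i)]

end SumsOfIndependent

section InnerProduct

variable {V : Type*} [NormedAddCommGroup V] [InnerProductSpace ℝ V]

lemma norm_sub_sq_convex_combination (a z w u g : V) (γ τ : ℝ)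
    (ha : a = τ • z + (1 - τ) • w - γ • g) :
    ‖a - u‖ ^ 2 + 2 * γ * ⟪g, a - u⟫ =
      τ * ‖z - u‖ ^ 2 + (1 - τ) * ‖w - u‖ ^ 2
        - (1 - τ) * ‖w - a‖ ^ 2 - τ * ‖a - z‖ ^ 2 := by
  have hz : ‖z - u‖ ^ 2 = ‖a - z‖ ^ 2 + 2 * ⟪z - a, a - u⟫ + ‖a - u‖ ^ 2 := by
    rw [norm_sub_rev a z, ← norm_add_sq_real, sub_add_sub_cancel]
  have hw : ‖w - u‖ ^ 2 = ‖w - a‖ ^ 2 + 2 * ⟪w - a, a - u⟫ + ‖a - u‖ ^ 2 := by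
    rw [← norm_add_sq_real, sub_add_sub_cancel]
  have hg : γ * ⟪g, a - u⟫ = τ * ⟪z - a, a - u⟫ + (1 - τ) * ⟪w - a, a - u⟫ := by
    simp only [← real_inner_smul_left, ← inner_add_left]
    congr 1
    rw [ha]
    module
  rw [hz, hw]
  linear_combination 2 * hg

variable {Ω : Type*} [MeasurableSpace Ω] {P : Measure Ω} [IsProbabilityMeasure P]

lemma norm_integral_sq_le_integral_norm_sq {X : Ω → V} (hX : MemLp X 2 P) :
    ‖∫ ω, X ω ∂P‖ ^ 2 ≤ ∫ ω, ‖X ω‖ ^ 2 ∂P := by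
  have h := variance_nonneg (fun ω ↦ ‖X ω‖) P
  rw [variance_eq_sub hX.norm] at h
  have h' : ‖∫ ω, X ω ∂P‖ ^ 2 ≤ (∫ ω, ‖X ω‖ ∂P) ^ 2 :=
    pow_le_pow_left₀ (norm_nonneg _) (norm_integral_le_integral_norm X) 2
  simp only [Pi.pow_apply] at h
  linarith

variable [MeasurableSpace V] [BorelSpace V]

lemma ProbabilityTheory.iIndepFun.integral_norm_sum_sq [CompleteSpace V] {ι : Type*} [Fintype ι]
    {X : ι → Ω → V} (hX : iIndepFun X P) (hL : ∀ i, MemLp (X i) 2 P) :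
    ∫ ω, ‖∑ i, X i ω‖ ^ 2 ∂P = ‖∑ i, ∫ ω, X i ω ∂P‖ ^ 2
      + ∑ i, (∫ ω, ‖X i ω‖ ^ 2 ∂P - ‖∫ ω, X i ω ∂P‖ ^ 2) := by
  classical
  have hint (i j : ι) : Integrable (fun ω ↦ ⟪X i ω, X j ω⟫) P :=
    ((hL i).norm.integrable_mul (hL j).norm).mono' ((hL i).1.inner (hL j).1)
      (.of_forall fun ω ↦ norm_inner_le_norm (𝕜 := ℝ) (X i ω) (X j ω))
  have hcross (i j : ι) : ∫ ω, ⟪X i ω, X j ω⟫ ∂P = ⟪∫ ω, X i ω ∂P, ∫ ω, X j ω ∂P⟫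
      + if i = j then ∫ ω, ‖X i ω‖ ^ 2 ∂P - ‖∫ ω, X i ω ∂P‖ ^ 2 else 0 := by
    split_ifs with hij
    · subst hij
      simp only [real_inner_self_eq_norm_sq]
      ring
    · rw [add_zero]
      exact (hX.indepFun hij).integral_bilin ((hL i).integrable one_le_two)
        ((hL j).integrable one_le_two) (innerSL ℝ)
  simp only [← real_inner_self_eq_norm_sq (∑ i, X i _),
    ← real_inner_self_eq_norm_sq (∑ i, ∫ ω, X i ω ∂P), sum_inner, inner_sum]
  rw [integral_finsetSum _ fun i _ ↦ integrable_finsetSum _ fun j _ ↦ hint _ _]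
  simp_rw [integral_finsetSum _ fun j _ ↦ hint _ _, hcross, sum_add_distrib]
  simp

/-- An unbiased compressor with independent randomness, applied to a random vector `X`: if the
output is square-integrable, then so is `X`, the mean is preserved, and the second moment grows by
at most the compression parameter. -/
lemma compressor_comp_moments [SecondCountableTopology V] {Ω' : Type*} [MeasurableSpace Ω']
    {P' : Measure Ω'} [IsProbabilityMeasure P'] {Q : V → Ω' → V} {q : ℝ}
    (hQm : Measurable (Function.uncurry Q)) (hQ : ∀ x, ∫ ω, Q x ω ∂P' = x)
    (hQ2 : ∀ x, ∫ ω, ‖Q x ω‖ ^ 2 ∂P' ≤ q * ‖x‖ ^ 2)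
    {X : Ω → V} (hX : Measurable X)
    (h : MemLp (fun p : Ω × Ω' ↦ Q (X p.1) p.2) 2 (P.prod P')) :
    MemLp X 2 P ∧ ∫ p, Q (X p.1) p.2 ∂(P.prod P') = ∫ ω, X ω ∂P ∧
      ∫ p, ‖Q (X p.1) p.2‖ ^ 2 ∂(P.prod P') ≤ q * ∫ ω, ‖X ω‖ ^ 2 ∂P := by
  have hint := (memLp_two_iff_integrable_sq_norm h.1).1 h
  have hXL : MemLp X 2 P := by
    rw [memLp_two_iff_integrable_sq_norm hX.aestronglyMeasurable]
    refine hint.integral_prod_left.mono' (by fun_prop) ?_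
    filter_upwards [hint.prod_right_ae] with ω hω
    have hmem : MemLp (Q (X ω)) 2 P' :=
      (memLp_two_iff_integrable_sq_norm
        (hQm.comp measurable_prodMk_left).aestronglyMeasurable).2 hω
    simpa [hQ] using norm_integral_sq_le_integral_norm_sq hmem
  refine ⟨hXL, ?_, ?_⟩
  · rw [integral_prod _ (h.integrable one_le_two)]
    simp only [hQ]
  · rw [integral_prod _ hint, ← integral_const_mul]
    exact integral_mono hint.integral_prod_left
      (((memLp_two_iff_integrable_sq_norm hXL.1).1 hXL).const_mul q) fun ω ↦ hQ2 (X ω)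

end InnerProduct

/-- **One-step descent inequality for MASHA1**: for fixed `z, w, u`, with
`z^{1/2} = τz + (1-τ)w - γF(w)` and
`z⁺ = z^{1/2} - γ·Q^serv[(1/M)·∑_m Q_m^dev(F_m(z^{1/2}) - F_m(w))]` (expectation over
the mutually independent compressor randomness),
`E‖z⁺ - u‖² ≤ τ‖z - u‖² + (1-τ)‖w - u‖² - 2γ⟪F(z^{1/2}), z^{1/2} - u⟫
  - (1 - τ - γ²C_q²)‖w - z^{1/2}‖² - τ‖z^{1/2} - z‖²`. -/
theorem masha1_one_step_inequality
    {d M : ℕ} (hM : 0 < M)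
    -- the operators
    (Fm : Fin M → EuclideanSpace ℝ (Fin d) → EuclideanSpace ℝ (Fin d))
    (F : EuclideanSpace ℝ (Fin d) → EuclideanSpace ℝ (Fin d))
    (hFdef : ∀ x, F x = (M : ℝ)⁻¹ • ∑ m, Fm m x)
    -- Lipschitz assumptions
    (L : ℝ) (Lm : Fin M → ℝ)
    (hLipF : LipschitzWith (Real.toNNReal L) F)
    (hLipFm : ∀ m, LipschitzWith (Real.toNNReal (Lm m)) (Fm m))
    (Ltilde : ℝ) (hLt : Ltilde = Real.sqrt ((M : ℝ)⁻¹ * ∑ m, Lm m ^ 2))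
    -- unbiased compressors: server with parameter `q^serv`, devices with `q_m^dev`;
    -- all evaluations are mutually independent (product randomness)
    {Ωs Ωd : Type*} [MeasurableSpace Ωs] [MeasurableSpace Ωd]
    (μs : Measure Ωs) (μd : Measure Ωd)
    [IsProbabilityMeasure μs] [IsProbabilityMeasure μd]
    (Qserv : EuclideanSpace ℝ (Fin d) → Ωs → EuclideanSpace ℝ (Fin d))
    (Qdev : Fin M → EuclideanSpace ℝ (Fin d) → Ωd → EuclideanSpace ℝ (Fin d))
    (qserv : ℝ) (qdev : Fin M → ℝ)
    (hqserv : 1 ≤ qserv) (hqdev : ∀ m, 1 ≤ qdev m)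
    (hQservMeas : Measurable (Function.uncurry Qserv))
    (hQdevMeas : ∀ m, Measurable (Function.uncurry (Qdev m)))
    (hQservUnbiased : ∀ x, ∫ ω, Qserv x ω ∂μs = x)
    (hQservMoment : ∀ x, ∫ ω, ‖Qserv x ω‖ ^ 2 ∂μs ≤ qserv * ‖x‖ ^ 2)
    (hQdevUnbiased : ∀ m x, ∫ ω, Qdev m x ω ∂μd = x)
    (hQdevMoment : ∀ m x, ∫ ω, ‖Qdev m x ω‖ ^ 2 ∂μd ≤ qdev m * ‖x‖ ^ 2)
    (Cq : ℝ)
    (hCq : Cq = Real.sqrt (qserv / (M : ℝ) ^ 2 *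
      ∑ m, (qdev m * Lm m ^ 2 + ((M : ℝ) - 1) * Ltilde ^ 2)))
    (γ τ : ℝ) (hγ : 0 < γ) (hτ : τ ∈ Set.Ioo (0 : ℝ) 1)
    (z w u : EuclideanSpace ℝ (Fin d))
    (zhalf : EuclideanSpace ℝ (Fin d))
    (hzhalf : zhalf = τ • z + (1 - τ) • w - γ • F w) :
    ∫ p, ‖(zhalf - γ • Qserv
          ((M : ℝ)⁻¹ • ∑ m, Qdev m (Fm m zhalf - Fm m w) (p.1 m)) p.2) - u‖ ^ 2
        ∂((Measure.pi fun _ : Fin M => μd).prod μs) ≤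
      τ * ‖z - u‖ ^ 2 + (1 - τ) * ‖w - u‖ ^ 2
        - 2 * γ * ⟪F zhalf, zhalf - u⟫
        - (1 - τ - γ ^ 2 * Cq ^ 2) * ‖w - zhalf‖ ^ 2
        - τ * ‖zhalf - z‖ ^ 2 := by
  have hM1 : (1 : ℝ) ≤ M := by exact_mod_cast hM
  have hM0 : (M : ℝ) ≠ 0 := by positivity
  set Δ : Fin M → EuclideanSpace ℝ (Fin d) := fun m ↦ Fm m zhalf - Fm m w
  set r := ‖w - zhalf‖
  have hΔle (m : Fin M) : ‖Δ m‖ ^ 2 ≤ Lm m ^ 2 * r ^ 2 := by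
    have h := (hLipFm m).norm_sub_le zhalf w
    rw [norm_sub_rev zhalf w, Real.coe_toNNReal'] at h
    calc ‖Δ m‖ ^ 2 ≤ (max (Lm m) 0 * r) ^ 2 := pow_le_pow_left₀ (norm_nonneg _) h 2
      _ = max (Lm m) 0 ^ 2 * r ^ 2 := mul_pow _ _ _
      _ ≤ Lm m ^ 2 * r ^ 2 := by
        gcongr ?_ * _
        rcases le_total (Lm m) 0 with h0 | h0
        · simpa [h0] using sq_nonneg (Lm m)
        · simp [h0]
  have hFΔ : F zhalf - F w = (M : ℝ)⁻¹ • ∑ m, Δ m := by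
    rw [hFdef, hFdef, ← smul_sub, ← sum_sub_distrib]
  have hCq2 : Cq ^ 2 = qserv * ((M : ℝ)⁻¹ ^ 2 * ∑ m, (qdev m + (M - 1)) * Lm m ^ 2) := by
    have hLt2 : Ltilde ^ 2 = (M : ℝ)⁻¹ * ∑ m, Lm m ^ 2 := by
      rw [hLt, Real.sq_sqrt (by positivity)]
    rw [hCq, Real.sq_sqrt]
    · simp only [sum_add_distrib, add_mul, ← mul_sum, sum_const, card_univ, Fintype.card_fin,
        nsmul_eq_mul, hLt2]
      field_simp
    · refine mul_nonneg (by positivity) (sum_nonneg fun m _ ↦ ?_)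
      have := hqdev m
      have : 0 ≤ (M : ℝ) - 1 := by linarith
      positivity
  have hbound : (M : ℝ)⁻¹ ^ 2 * (‖∑ m, Δ m‖ ^ 2 + ∑ m, (qdev m * ‖Δ m‖ ^ 2 - ‖Δ m‖ ^ 2)) ≤
      (M : ℝ)⁻¹ ^ 2 * ((∑ m, (qdev m + (M - 1)) * Lm m ^ 2) * r ^ 2) := by
    gcongr
    have h := norm_sum_sq_le_card_mul_sum_norm_sq univ Δ
    rw [card_univ, Fintype.card_fin] at h
    calc _ ≤ M * ∑ m, ‖Δ m‖ ^ 2 + ∑ m, (qdev m * ‖Δ m‖ ^ 2 - ‖Δ m‖ ^ 2) := by gcongr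
      _ = ∑ m, (qdev m + (M - 1)) * ‖Δ m‖ ^ 2 := by
        rw [mul_sum, ← sum_add_distrib]
        exact sum_congr rfl fun m _ ↦ by ring
      _ ≤ ∑ m, (qdev m + (M - 1)) * (Lm m ^ 2 * r ^ 2) := by
        gcongr with m
        · linarith [hqdev m]
        · exact hΔle m
      _ = _ := by simp only [sum_mul, mul_assoc]
  have hrhs : τ * ‖z - u‖ ^ 2 + (1 - τ) * ‖w - u‖ ^ 2 - 2 * γ * ⟪F zhalf, zhalf - u⟫
        - (1 - τ - γ ^ 2 * Cq ^ 2) * r ^ 2 - τ * ‖zhalf - z‖ ^ 2 =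
      ‖zhalf - u‖ ^ 2 - 2 * γ * ⟪F zhalf - F w, zhalf - u⟫ + γ ^ 2 * (Cq ^ 2 * r ^ 2) := by
    rw [inner_sub_left]
    linear_combination -norm_sub_sq_convex_combination zhalf z w u (F w) γ τ hzhalf
  rw [hrhs]
  set X : (Fin M → Ωd) → EuclideanSpace ℝ (Fin d) :=
    fun p ↦ (M : ℝ)⁻¹ • ∑ m, Qdev m (Δ m) (p m) with hX
  set Y : (Fin M → Ωd) × Ωs → EuclideanSpace ℝ (Fin d) := fun p ↦ Qserv (X p.1) p.2
  have hQm (m : Fin M) : Measurable (Qdev m (Δ m)) := (hQdevMeas m).comp measurable_prodMk_left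
  have hXm : Measurable X := by fun_prop
  have hYm : Measurable Y :=
    hQservMeas.comp ((hXm.comp measurable_fst).prodMk measurable_snd)
  have hexpand (y : EuclideanSpace ℝ (Fin d)) : ‖(zhalf - γ • y) - u‖ ^ 2 =
      ‖zhalf - u‖ ^ 2 - 2 * γ * ⟪zhalf - u, y⟫ + γ ^ 2 * ‖y‖ ^ 2 := by
    rw [sub_right_comm, norm_sub_sq_real, real_inner_smul_right, norm_smul, mul_pow,
      Real.norm_eq_abs, sq_abs]
    ring
  change ∫ p, ‖(zhalf - γ • Y p) - u‖ ^ 2 ∂_ ≤ _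
  by_cases hint : Integrable (fun p ↦ ‖(zhalf - γ • Y p) - u‖ ^ 2)
      ((Measure.pi fun _ : Fin M ↦ μd).prod μs)
  · have hYL : MemLp Y 2 ((Measure.pi fun _ : Fin M ↦ μd).prod μs) := by
      have h := (memLp_two_iff_integrable_sq_norm (by fun_prop)).2 hint
      refine (((memLp_const (zhalf - u)).sub h).const_smul γ⁻¹).ae_eq (.of_forall fun p ↦ ?_)
      simp only [Pi.smul_apply, Pi.sub_apply]
      rw [sub_sub_sub_cancel_right, sub_sub_cancel, inv_smul_smul₀ hγ.ne']
    obtain ⟨hXL, hmean, hmoment⟩ :=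
      compressor_comp_moments hQservMeas hQservUnbiased hQservMoment hXm hYL
    set D : Fin M → (Fin M → Ωd) → EuclideanSpace ℝ (Fin d) :=
      fun m p ↦ Qdev m (Δ m) (p m) with hD
    have hDindep : iIndepFun D (Measure.pi fun _ : Fin M ↦ μd) :=
      iIndepFun_pi (X := fun m ↦ Qdev m (Δ m)) fun m ↦ (hQm m).aemeasurable
    have hDL : ∀ m, MemLp (D m) 2 (Measure.pi fun _ : Fin M ↦ μd) := by
      refine hDindep.memLp_two_of_memLp_sum (fun m ↦ by fun_prop) ?_
      convert hXL.const_smul (M : ℝ) using 1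
      ext1 p
      simp [hX, hD, smul_inv_smul₀ hM0]
    have hDmean (m : Fin M) : ∫ p, D m p ∂(Measure.pi fun _ : Fin M ↦ μd) = Δ m := by
      rw [← hQdevUnbiased m (Δ m)]
      exact integral_comp_eval (μ := fun _ ↦ μd) (hQm m).aestronglyMeasurable
    have hDmoment (m : Fin M) :
        ∫ p, ‖D m p‖ ^ 2 ∂(Measure.pi fun _ : Fin M ↦ μd) ≤ qdev m * ‖Δ m‖ ^ 2 := by
      refine le_of_eq_of_le ?_ (hQdevMoment m (Δ m))
      exact integral_comp_eval (μ := fun _ ↦ μd) (f := fun ω ↦ ‖Qdev m (Δ m) ω‖ ^ 2)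
        ((hQm m).norm.pow_const 2).aestronglyMeasurable
    have hXmean : ∫ p, X p ∂(Measure.pi fun _ : Fin M ↦ μd) = F zhalf - F w := by
      rw [integral_smul, integral_finsetSum _ fun m _ ↦ (hDL m).integrable one_le_two, hFΔ]
      simp only [hDmean]
    have hXmoment : ∫ p, ‖X p‖ ^ 2 ∂(Measure.pi fun _ : Fin M ↦ μd) ≤
        (M : ℝ)⁻¹ ^ 2 * ((∑ m, (qdev m + (M - 1)) * Lm m ^ 2) * r ^ 2) := by
      refine le_trans ?_ hbound
      simp only [hX, norm_smul, mul_pow, norm_inv, Real.norm_natCast]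
      rw [integral_const_mul, hDindep.integral_norm_sum_sq hDL]
      simp only [hDmean]
      gcongr with m
      exact hDmoment m
    have hYint := hYL.integrable one_le_two
    have hY2int := (memLp_two_iff_integrable_sq_norm hYL.1).1 hYL
    have hYinner : Integrable (fun p ↦ ⟪zhalf - u, Y p⟫)
        ((Measure.pi fun _ : Fin M ↦ μd).prod μs) := hYint.const_inner _
    calc _ = ‖zhalf - u‖ ^ 2 - 2 * γ * ⟪zhalf - u, F zhalf - F w⟫
          + γ ^ 2 * ∫ p, ‖Y p‖ ^ 2 ∂((Measure.pi fun _ : Fin M ↦ μd).prod μs) := by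
          simp only [hexpand]
          rw [integral_add (by fun_prop) (by fun_prop),
            integral_sub (integrable_const _) (hYinner.const_mul _), integral_const_mul,
            integral_const_mul, integral_inner hYint, hmean, hXmean]
          simp
      _ ≤ _ := by
          rw [real_inner_comm]
          gcongr
          refine hmoment.trans ?_
          rw [hCq2, mul_assoc, mul_assoc]
          gcongr
  · rw [integral_undef hint]
    have hF : ‖F zhalf - F w‖ ^ 2 ≤ Cq ^ 2 * r ^ 2 := by
      have hsum : 0 ≤ ∑ m, (qdev m * ‖Δ m‖ ^ 2 - ‖Δ m‖ ^ 2) :=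
        sum_nonneg fun m _ ↦ by nlinarith [hqdev m, sq_nonneg ‖Δ m‖]
      have h : ‖F zhalf - F w‖ ^ 2 ≤
          (M : ℝ)⁻¹ ^ 2 * ((∑ m, (qdev m + (M - 1)) * Lm m ^ 2) * r ^ 2) := by
        refine le_trans ?_ hbound
        rw [hFΔ, norm_smul, mul_pow, norm_inv, Real.norm_natCast]
        gcongr
        linarith
      rw [hCq2, mul_assoc, mul_assoc]
      exact h.trans (le_mul_of_one_le_left ((sq_nonneg _).trans h) hqserv)
    have h := (sq_nonneg _).trans_eq (hexpand (F zhalf - F w))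
    rw [real_inner_comm] at h
    have := mul_le_mul_of_nonneg_left hF (sq_nonneg γ)
    linarith
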